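/- arXiv:2501.00335 — 5 statements merged into one kernel-verified Lean document; each statement's English description precedes it below -/
import Mathlib

section
/- For every positive integer n, there exists a bijection between the set 𝔚_n of weakly increasing 3-dimensional permutations of length n and the set 𝒮_n of snakes of length n; in particular |𝔚_n| = |𝒮_n|. -/
/-- A weakly increasing 3-dimensional permutation of length `n`: a pair `(σ, π)`
of permutations with `max (σ i) (π i)` weakly increasing in `i`. -/
def IsWIP3 (n : ℕ) (p : Equiv.Perm (Fin n) × Equiv.Perm (Fin n)) : Prop :=
  ∀ i j : Fin n, i ≤ j → max (p.1 i) (p.2 i) ≤ max (p.1 j) (p.2 j)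

/-- A signed permutation of length `n`: a sequence of nonzero integers whose
absolute values form a permutation of `{1, …, n}`. -/
def IsSignedPerm (n : ℕ) (π : Fin n → ℤ) : Prop :=
  Function.Injective (fun i => (π i).natAbs) ∧
  ∀ i, 1 ≤ (π i).natAbs ∧ (π i).natAbs ≤ n

/-- The down-up (alternating) property `a₁ > a₂ < a₃ > a₄ < ⋯` (positions `0`-indexed). -/
def DownUpZ (n : ℕ) (a : Fin n → ℤ) : Prop :=
  ∀ i : ℕ, ∀ h : i + 1 < n,
    if i % 2 = 0 then a ⟨i + 1, h⟩ < a ⟨i, by omega⟩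
    else a ⟨i, by omega⟩ < a ⟨i + 1, h⟩

/-- A snake of length `n`: a signed permutation with `π₁ > 0` satisfying the down-up property. -/
def IsSnake (n : ℕ) (π : Fin n → ℤ) : Prop :=
  IsSignedPerm n π ∧ (∀ h : 0 < n, 0 < π ⟨0, h⟩) ∧ DownUpZ n π

section

open Finset

/-- The cyclic valleys of a permutation. -/
def cyclicValleys {n : ℕ} (e : Equiv.Perm (Fin n)) : Finset (Fin n) :=
  {i | i < e i ∧ i < e.symm i}

/-- The valleys of the word `w`, with a sentinel `-∞` in front and `∞` at the end. -/
def wordValleys {n : ℕ} (w : Equiv.Perm (Fin n)) : Finset (Fin n) :=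
  {i | (∃ k : Fin n, (k : ℕ) + 1 = i ∧ w i < w k) ∧
    ∀ k : Fin n, (i : ℕ) + 1 = k → w i < w k}

/-- Insert a new smallest letter at position `j` of the word `w`. -/
def insertMin {n : ℕ} (j : Fin (n + 1)) (w : Equiv.Perm (Fin n)) : Equiv.Perm (Fin (n + 1)) :=
  ((finSuccEquiv' j).trans (Equiv.optionCongr w)).trans (finSuccEquiv' 0).symm

theorem insertMin_self {n : ℕ} (j : Fin (n + 1)) (w : Equiv.Perm (Fin n)) :
    insertMin j w j = 0 := by
  simp [insertMin]

theorem insertMin_succAbove {n : ℕ} (j : Fin (n + 1)) (w : Equiv.Perm (Fin n)) (i : Fin n) :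
    insertMin j w (j.succAbove i) = (w i).succ := by
  simp [insertMin]

theorem insertMin_bijective (n : ℕ) : Function.Bijective
    (fun x : Fin (n + 1) × Equiv.Perm (Fin n) => insertMin x.1 x.2) := by
  rw [Fintype.bijective_iff_injective_and_card]
  constructor
  · rintro ⟨j, w⟩ ⟨j', w'⟩ h
    simp only at h
    have hj : j = j' := by
      apply (insertMin j w).injective
      rw [insertMin_self, h, insertMin_self]
    subst hj
    congr 1
    ext i : 1
    have := congrArg (fun e => e (j.succAbove i)) h
    simpa [insertMin_succAbove] using this
  · simp [Fintype.card_perm, Nat.factorial_succ]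

theorem card_filter_univ_succAbove {n : ℕ} (S : Finset (Fin (n + 1))) (j : Fin (n + 1)) :
    #S = (if j ∈ S then 1 else 0) + #{i : Fin n | j.succAbove i ∈ S} := by
  have h : #S = ∑ i, if i ∈ S then 1 else 0 := by simp
  rw [h, Fin.sum_univ_succAbove _ j]
  simp

theorem card_cyclicValleys_zero {n : ℕ} (e : Equiv.Perm (Fin n)) :
    #(cyclicValleys (Equiv.Perm.decomposeFin.symm (0, e))) = #(cyclicValleys e) := by
  rw [card_filter_univ_succAbove _ 0, if_neg (by simp [cyclicValleys]), zero_add]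
  congr 1
  ext i
  have h : (Equiv.Perm.decomposeFin.symm (0, e)).symm i.succ = (e.symm i).succ := by
    rw [Equiv.symm_apply_eq]; simp
  simp [cyclicValleys, h]

theorem card_cyclicValleys_succ {n : ℕ} (p : Fin n) (e : Equiv.Perm (Fin n)) :
    #(cyclicValleys (Equiv.Perm.decomposeFin.symm (p.succ, e))) =
      1 + #(cyclicValleys e \ {p, e.symm p}) := by
  set e' := Equiv.Perm.decomposeFin.symm (p.succ, e) with he'
  have hs : ∀ i, e' i.succ = if i = e.symm p then 0 else (e i).succ := by
    intro i
    rw [he', Equiv.Perm.decomposeFin_symm_apply_succ]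
    split_ifs with h
    · simp [h]
    · apply Equiv.swap_apply_of_ne_of_ne (Fin.succ_ne_zero _)
      rw [Ne, Fin.succ_inj, ← Equiv.eq_symm_apply]
      exact h
  have h0 : e' 0 = p.succ := by simp [he']
  have hi : ∀ i, e'.symm i.succ = if i = p then 0 else (e.symm i).succ := by
    intro i
    rw [Equiv.symm_apply_eq]
    split_ifs with h
    · rw [h, h0]
    · rw [hs, if_neg (by simpa using h), Equiv.apply_symm_apply]
  have hi0 : e'.symm 0 = (e.symm p).succ := by
    rw [Equiv.symm_apply_eq, hs, if_pos rfl]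
  rw [card_filter_univ_succAbove _ 0, if_pos (by simp [cyclicValleys, h0, hi0])]
  congr 2
  ext i
  simp only [cyclicValleys, Fin.zero_succAbove, mem_filter, mem_univ, true_and, hs, hi, mem_sdiff,
    mem_insert, mem_singleton]
  split_ifs with h1 h2 h2 <;> simp [h1, h2]

theorem card_wordValleys_zero {n : ℕ} (w : Equiv.Perm (Fin n)) :
    #(wordValleys (insertMin 0 w)) = #(wordValleys w) := by
  have hs : ∀ i, insertMin 0 w i.succ = (w i).succ := insertMin_succAbove 0 w
  rw [card_filter_univ_succAbove _ 0, if_neg (by simp [wordValleys]), zero_add]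
  congr 1
  ext i
  simp [wordValleys, Fin.exists_fin_succ, Fin.forall_fin_succ, hs, insertMin_self]

theorem eq_finRotate_iff_of_mem_wordValleys {n : ℕ} {w : Equiv.Perm (Fin n)} {i : Fin n}
    (hi : i ∈ wordValleys w) (p : Fin n) : i = finRotate n p ↔ (i : ℕ) = p + 1 := by
  obtain _ | n := n
  · exact i.elim0
  · simp only [wordValleys, mem_filter, mem_univ, true_and] at hi
    obtain ⟨⟨k, hk, -⟩, -⟩ := hi
    rw [Fin.ext_iff, coe_finRotate]
    split_ifs with h
    · simp only [h, Fin.val_last]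
      omega
    · rfl

theorem card_wordValleys_succ {n : ℕ} (p : Fin n) (w : Equiv.Perm (Fin n)) :
    #(wordValleys (insertMin p.succ w)) = 1 + #(wordValleys w \ {p, finRotate n p}) := by
  have hs := insertMin_succAbove p.succ w
  have h0 := insertMin_self p.succ w
  set w' := insertMin p.succ w
  have hpos : ∀ k, k ≠ p.succ → w' p.succ < w' k := by
    intro k hk
    rw [h0, Fin.pos_iff_ne_zero, ← h0]
    exact fun h => hk (w'.injective h)
  rw [card_filter_univ_succAbove _ p.succ, if_pos]
  · congr 2
    ext i
    rw [mem_sdiff, mem_insert, mem_singleton, not_or]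
    have hval : ∀ k : Fin n, (p.succ.succAbove k : ℕ) = if (k : ℕ) ≤ p then (k : ℕ) else k + 1 := by
      intro k
      simp only [Fin.succAbove, Fin.lt_def, Fin.val_castSucc, Fin.val_succ, Nat.lt_succ_iff]
      split_ifs <;> simp
    have hiff : p.succ.succAbove i ∈ wordValleys w' ↔
        i ∈ wordValleys w ∧ i ≠ p ∧ (i : ℕ) ≠ p + 1 := by
      simp only [wordValleys, mem_filter, mem_univ, true_and, Fin.exists_iff_succAbove p.succ,
        Fin.forall_iff_succAbove p.succ, h0, hs, hval, Fin.not_lt_zero, and_false, false_or,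
        Fin.succ_lt_succ_iff, Fin.val_succ, imp_false, ne_eq, Fin.ext_iff]
      constructor
      · rintro ⟨⟨k, hk, hlt⟩, hne, hr⟩
        refine ⟨⟨⟨k, by grind, hlt⟩, fun k' hk' => hr k' (by grind)⟩, by grind, by grind⟩
      · rintro ⟨⟨⟨k, hk, hlt⟩, hr⟩, hne, hne'⟩
        exact ⟨⟨k, by grind, hlt⟩, by grind, fun k' hk' => hr k' (by grind)⟩
    rw [mem_filter_univ, hiff]
    refine and_congr_right fun hi => and_congr_right fun _ => not_congr ?_
    exact (eq_finRotate_iff_of_mem_wordValleys hi p).symm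
  · simp only [wordValleys, mem_filter, mem_univ, true_and]
    refine ⟨⟨p.castSucc, by simp, hpos _ ?_⟩, fun k hk => hpos k ?_⟩
    · exact Fin.castSucc_lt_succ.ne
    · rintro rfl; omega

theorem sum_insert_stat {n : ℕ} (F : ℕ → ℕ) (V : Finset (Fin n)) (c : Equiv.Perm (Fin n))
    (hV : ∀ p ∈ V, c p ∉ V) :
    ∑ p, F (1 + #(V \ {p, c p})) = 2 * #V * F #V + (n - 2 * #V) * F (#V + 1) := by
  have key : ∀ p, F (1 + #(V \ {p, c p})) =
      if p ∈ V ∪ V.map c.symm.toEmbedding then F #V else F (#V + 1) := by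
    intro p
    have hm : p ∈ V.map c.symm.toEmbedding ↔ c p ∈ V := by
      simp
    simp only [mem_union, hm]
    split_ifs with h
    · congr 1
      have : #(V \ {p, c p}) + 1 = #V := by
        rcases h with h | h
        · rw [sdiff_insert, sdiff_singleton_eq_erase, erase_eq_of_notMem (hV p h)]
          exact card_erase_add_one h
        · rw [sdiff_insert, sdiff_singleton_eq_erase, erase_eq_of_notMem]
          · exact card_erase_add_one h
          · intro h'
            exact hV p (mem_of_mem_erase h') h
      omega
    · push Not at h
      rw [sdiff_eq_self_of_disjoint (by simp [h]), add_comm]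
  have hd : Disjoint V (V.map c.symm.toEmbedding) := by
    rw [disjoint_left]
    intro p hp
    simpa using hV p hp
  have hc : #(V ∪ V.map c.symm.toEmbedding) = 2 * #V := by
    rw [card_union_of_disjoint hd, card_map]; ring
  rw [sum_congr rfl fun p _ => key p, sum_ite, sum_const, sum_const, filter_mem_eq_inter,
    filter_notMem_eq_sdiff, univ_inter, ← compl_eq_univ_sdiff, card_compl, hc]
  simp

theorem sum_stat_succ {n : ℕ} (F : ℕ → ℕ) (V : Equiv.Perm (Fin n) → Finset (Fin n))
    (V' : Equiv.Perm (Fin (n + 1)) → Finset (Fin (n + 1)))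
    (c : Equiv.Perm (Fin n) → Equiv.Perm (Fin n))
    (E : Fin (n + 1) × Equiv.Perm (Fin n) → Equiv.Perm (Fin (n + 1)))
    (hE : Function.Bijective E) (hV : ∀ e, ∀ p ∈ V e, c e p ∉ V e)
    (h0 : ∀ e, #(V' (E (0, e))) = #(V e))
    (hs : ∀ e p, #(V' (E (p.succ, e))) = 1 + #(V e \ {p, c e p})) :
    ∑ e, F #(V' e) =
      ∑ e, (F #(V e) + (2 * #(V e) * F #(V e) + (n - 2 * #(V e)) * F (#(V e) + 1))) := by
  rw [← hE.sum_comp, Fintype.sum_prod_type_right]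
  refine sum_congr rfl fun e _ => ?_
  simp only [Fin.sum_univ_succ, h0, hs, sum_insert_stat F (V e) (c e) (hV e)]

theorem sum_cyclicValleys_eq_sum_wordValleys (n : ℕ) (F : ℕ → ℕ) :
    ∑ e : Equiv.Perm (Fin n), F #(cyclicValleys e) =
      ∑ w : Equiv.Perm (Fin n), F #(wordValleys w) := by
  induction n generalizing F with
  | zero => simp [Finset.eq_empty_of_isEmpty]
  | succ n ih =>
    rw [sum_stat_succ F cyclicValleys cyclicValleys Equiv.symm _
        Equiv.Perm.decomposeFin.symm.bijective _ card_cyclicValleys_zero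
        (fun e p => card_cyclicValleys_succ p e),
      sum_stat_succ F wordValleys wordValleys (fun _ => finRotate n) _
        (insertMin_bijective n) _ card_wordValleys_zero (fun e p => card_wordValleys_succ p e)]
    · exact ih fun v => F v + (2 * v * F v + (n - 2 * v) * F (v + 1))
    · intro w p hp hq
      have hv := (eq_finRotate_iff_of_mem_wordValleys hq p).1 rfl
      simp only [wordValleys, mem_filter, mem_univ, true_and] at hp hq
      obtain ⟨⟨k, hk, hlt⟩, -⟩ := hq
      obtain rfl : k = p := Fin.ext (by omega)
      exact lt_asymm hlt (hp.2 _ hv.symm)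
    · intro e p hp hq
      simp only [cyclicValleys, mem_filter, mem_univ, true_and, Equiv.apply_symm_apply] at hp hq
      exact lt_asymm hp.2 hq.1

/-- The cyclic peaks of a permutation. -/
def cyclicPeaks {n : ℕ} (e : Equiv.Perm (Fin n)) : Finset (Fin n) :=
  {i | e i < i ∧ e.symm i < i}

theorem sum_cyclicPeaks_eq_sum_cyclicValleys (n : ℕ) (F : ℕ → ℕ) :
    ∑ e : Equiv.Perm (Fin n), F #(cyclicPeaks e) =
      ∑ e : Equiv.Perm (Fin n), F #(cyclicValleys e) := by
  have hsymm : ∀ e : Equiv.Perm (Fin n), Equiv.symm (Fin.revPerm.permCongr e) =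
      Fin.revPerm.permCongr (Equiv.symm e) := fun e => rfl
  rw [← (Fin.revPerm (n := n)).permCongr.sum_comp (fun e => F #(cyclicValleys e))]
  refine sum_congr rfl fun e _ => ?_
  congr 1
  rw [← card_map Fin.revPerm.toEmbedding]
  congr 1
  ext i
  simp [cyclicPeaks, cyclicValleys, hsymm, Fin.lt_rev_iff, -Equiv.permCongr_eq_mul]

theorem factorial_card_max_fiber {n : ℕ} (e : Equiv.Perm (Fin n)) (k : Fin n) :
    (Fintype.card {a // max a (e a) = k}).factorial = if k ∈ cyclicPeaks e then 2 else 1 := by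
  rw [Fintype.card_subtype]
  have hmem : ∀ a, max a (e a) = k → a = k ∧ e k ≤ k ∨ a = e.symm k ∧ e.symm k ≤ k := by
    intro a ha
    rcases max_choice a (e a) with h | h
    · left; grind
    · right
      have : a = e.symm k := by rw [Equiv.eq_symm_apply]; grind
      grind
  split_ifs with h
  · simp only [cyclicPeaks, mem_filter, mem_univ, true_and] at h
    have : ({a | max a (e a) = k} : Finset (Fin n)) = {k, e.symm k} := by
      ext a
      simp only [mem_filter, mem_univ, true_and, mem_insert, mem_singleton]
      constructor
      · intro ha; have := hmem a ha; tauto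
      · rintro (rfl | rfl)
        · exact max_eq_left h.1.le
        · simpa using h.2.le
    rw [this, card_pair h.2.ne']; rfl
  · rw [Nat.factorial_eq_one, card_le_one]
    simp only [cyclicPeaks, mem_filter, mem_univ, true_and] at h ⊢
    intro a ha b hb
    have h1 : e k = k ↔ e.symm k = k := by rw [Equiv.symm_apply_eq]; exact eq_comm
    have := hmem a ha
    have := hmem b hb
    grind

theorem card_sorting_perms {n : ℕ} (f : Fin n → Fin n) :
    Nat.card {s : Equiv.Perm (Fin n) // Monotone (f ∘ s)} =
      ∏ k, (Fintype.card {a // f a = k}).factorial := by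
  rw [← DomMulAct.stabilizer_card f, ← Nat.card_eq_fintype_card]
  refine Nat.card_congr ((Equiv.mulRight (Tuple.sort f)⁻¹).subtypeEquiv fun s => ?_)
  rw [← Tuple.comp_sort_eq_comp_iff_monotone]
  simp only [Equiv.coe_mulRight, funext_iff, Function.comp_apply, Equiv.Perm.mul_apply,
    Equiv.Perm.inv_def]
  constructor
  · intro h a
    rw [h, Equiv.apply_symm_apply]
  · intro h a
    rw [← h (Tuple.sort f a), Equiv.symm_apply_apply]

theorem card_wip3 (n : ℕ) :
    Nat.card {p : Equiv.Perm (Fin n) × Equiv.Perm (Fin n) // IsWIP3 n p} =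
      ∑ e : Equiv.Perm (Fin n), 2 ^ #(cyclicPeaks e) := by
  let φ : {p : Equiv.Perm (Fin n) × Equiv.Perm (Fin n) // IsWIP3 n p} ≃
      Σ e : Equiv.Perm (Fin n), {s : Equiv.Perm (Fin n) // Monotone ((fun a => max a (e a)) ∘ s)} :=
    { toFun := fun p => ⟨p.1.2 * p.1.1⁻¹, p.1.1, fun i j hij => by
        simpa only [Function.comp_apply, Equiv.Perm.mul_apply, Equiv.Perm.inv_def,
          Equiv.symm_apply_apply] using p.2 i j hij⟩
      invFun := fun x => ⟨(x.2.1, x.1 * x.2.1), fun i j hij => x.2.2 hij⟩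
      left_inv := fun p => by simp
      right_inv := by
        rintro ⟨e, s, hs⟩
        have h : e * s * s⁻¹ = e := by simp
        ext : 1
        · exact h
        · simp only }
  rw [Nat.card_congr φ, Nat.card_sigma]
  refine sum_congr rfl fun e _ => ?_
  rw [card_sorting_perms, prod_congr rfl fun k _ => factorial_card_max_fiber e k, prod_ite]
  simp

/-- The signed sequence with absolute values `w + 1` whose entry at position `i` is positive
exactly if either `i` is even or `i ∈ s`, but not both. -/
def signedWord {n : ℕ} (w : Equiv.Perm (Fin n)) (s : Finset (Fin n)) (i : Fin n) : ℤ :=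
  if (i : ℕ) % 2 = 0 ↔ i ∉ s then (w i : ℤ) + 1 else -((w i : ℤ) + 1)

theorem natAbs_signedWord {n : ℕ} (w : Equiv.Perm (Fin n)) (s : Finset (Fin n)) (i : Fin n) :
    (signedWord w s i).natAbs = w i + 1 := by
  unfold signedWord
  split_ifs <;> omega

theorem signedWord_pos_iff {n : ℕ} (w : Equiv.Perm (Fin n)) (s : Finset (Fin n)) (i : Fin n) :
    0 < signedWord w s i ↔ ((i : ℕ) % 2 = 0 ↔ i ∉ s) := by
  unfold signedWord
  split_ifs with h <;> simp only [h, iff_true, iff_false] <;> omega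

theorem isSignedPerm_signedWord {n : ℕ} (w : Equiv.Perm (Fin n)) (s : Finset (Fin n)) :
    IsSignedPerm n (signedWord w s) := by
  simp only [IsSignedPerm, natAbs_signedWord]
  refine ⟨fun i j h => w.injective (Fin.ext (by simpa using h)), fun i => ⟨by omega, (w i).2⟩⟩

theorem signedWord_inj {n : ℕ} {w w' : Equiv.Perm (Fin n)} {s s' : Finset (Fin n)}
    (h : signedWord w s = signedWord w' s') : w = w' ∧ s = s' := by
  constructor
  · ext i
    have := natAbs_signedWord w s i
    rw [h, natAbs_signedWord] at this
    omega
  · ext i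
    have := signedWord_pos_iff w s i
    rw [h, signedWord_pos_iff] at this
    tauto

theorem IsSignedPerm.exists_eq_signedWord {n : ℕ} {π : Fin n → ℤ} (h : IsSignedPerm n π) :
    ∃ w s, signedWord w s = π := by
  have hb (i) := h.2 i
  let f : Fin n → Fin n := fun i => ⟨(π i).natAbs - 1, by have := hb i; omega⟩
  have hf : Function.Injective f := by
    intro i j hij
    apply h.1
    have := hb i
    have := hb j
    simp only [f, Fin.mk.injEq] at hij
    simp only
    omega
  refine ⟨Equiv.ofBijective f (Finite.injective_iff_bijective.1 hf),
    ({i | (i : ℕ) % 2 = 0 ↔ π i < 0} : Finset (Fin n)), ?_⟩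
  ext i
  have := hb i
  simp only [signedWord, Equiv.ofBijective_apply, mem_filter_univ, f]
  split_ifs <;> omega

theorem downUpZ_signedWord_iff {n : ℕ} (w : Equiv.Perm (Fin n)) (s : Finset (Fin n)) :
    DownUpZ n (signedWord w s) ↔ ∀ i j : Fin n, (i : ℕ) + 1 = j →
      (i ∈ s → w i < w j) ∧ (j ∈ s → w j < w i) := by
  have key : ∀ i j : Fin n, (i : ℕ) + 1 = j →
      ((if (i : ℕ) % 2 = 0 then signedWord w s j < signedWord w s i
        else signedWord w s i < signedWord w s j) ↔
      (i ∈ s → w i < w j) ∧ (j ∈ s → w j < w i)) := by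
    intro i j hij
    have hne : (w i : ℕ) ≠ w j := fun h => by
      have := w.injective (Fin.ext h)
      omega
    have hj : (j : ℕ) % 2 = 0 ↔ ¬ (i : ℕ) % 2 = 0 := by omega
    simp only [signedWord, hj, Fin.lt_def]
    by_cases h1 : (i : ℕ) % 2 = 0 <;> by_cases h2 : i ∈ s <;> by_cases h3 : j ∈ s <;>
      simp [h1, h2, h3] <;> omega
  constructor
  · intro h i j hij
    obtain ⟨j, hj⟩ := j
    simp only at hij
    subst hij
    exact (key _ _ rfl).1 (h i hj)
  · intro h i hi
    exact (key ⟨i, by omega⟩ ⟨i + 1, hi⟩ rfl).2 (h _ _ rfl)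

theorem isSnake_signedWord_iff {n : ℕ} (w : Equiv.Perm (Fin n)) (s : Finset (Fin n)) :
    IsSnake n (signedWord w s) ↔ s ⊆ wordValleys w := by
  simp only [IsSnake, isSignedPerm_signedWord, true_and, signedWord_pos_iff,
    downUpZ_signedWord_iff, Nat.zero_mod, true_iff]
  constructor
  · rintro ⟨h0, h⟩ i hi
    simp only [wordValleys, mem_filter, mem_univ, true_and]
    refine ⟨?_, fun k hk => (h i k hk).1 hi⟩
    obtain ⟨i, hin⟩ := i
    obtain _ | i := i
    · exact absurd hi (h0 hin)
    · exact ⟨⟨i, by omega⟩, rfl, (h ⟨i, by omega⟩ _ rfl).2 hi⟩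
  · intro h
    refine ⟨fun hn hs => ?_, fun i j hij => ⟨fun hi => ?_, fun hj => ?_⟩⟩
    · have := h hs
      simp [wordValleys] at this
    · exact (mem_filter.1 (h hi)).2.2 j hij
    · obtain ⟨k, hk, hlt⟩ := (mem_filter.1 (h hj)).2.1
      obtain rfl : k = i := Fin.ext (by omega)
      exact hlt

/-- Snakes are words together with a set of valleys. -/
noncomputable def snakeEquiv (n : ℕ) :
    (Σ w : Equiv.Perm (Fin n), (wordValleys w).powerset) ≃ {π : Fin n → ℤ // IsSnake n π} :=
  Equiv.ofBijective
    (fun x => ⟨signedWord x.1 x.2.1, (isSnake_signedWord_iff _ _).2 (mem_powerset.1 x.2.2)⟩) <| by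
    constructor
    · rintro ⟨w, s, hs⟩ ⟨w', s', hs'⟩ h
      obtain ⟨rfl, rfl⟩ := signedWord_inj (Subtype.ext_iff.1 h)
      rfl
    · rintro ⟨π, hπ⟩
      obtain ⟨w, s, rfl⟩ := hπ.1.exists_eq_signedWord
      exact ⟨⟨w, s, mem_powerset.2 ((isSnake_signedWord_iff w s).1 hπ)⟩, rfl⟩

theorem card_snake (n : ℕ) : Nat.card {π : Fin n → ℤ // IsSnake n π} =
    ∑ w : Equiv.Perm (Fin n), 2 ^ #(wordValleys w) := by
  rw [← Nat.card_congr (snakeEquiv n), Nat.card_sigma]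
  refine sum_congr rfl fun w _ => ?_
  rw [Nat.card_eq_fintype_card, Fintype.card_coe, card_powerset]

theorem card_wip3_eq_card_snake (n : ℕ) :
    Nat.card {p : Equiv.Perm (Fin n) × Equiv.Perm (Fin n) // IsWIP3 n p} =
      Nat.card {π : Fin n → ℤ // IsSnake n π} := by
  rw [card_wip3, card_snake, sum_cyclicPeaks_eq_sum_cyclicValleys n (2 ^ ·),
    sum_cyclicValleys_eq_sum_wordValleys n (2 ^ ·)]

end

/-- For every positive integer `n` there is a bijection between the set
`𝔚ₙ` of weakly increasing 3-dimensional permutations of length `n` and the set `𝒮ₙ` of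
snakes of length `n`; in particular `|𝔚ₙ| = |𝒮ₙ|`. -/
theorem wip_equiv_snake (n : ℕ) (hn : 0 < n) :
    Nonempty ({p : Equiv.Perm (Fin n) × Equiv.Perm (Fin n) // IsWIP3 n p} ≃
      {π : Fin n → ℤ // IsSnake n π}) ∧
    Nat.card {p : Equiv.Perm (Fin n) × Equiv.Perm (Fin n) // IsWIP3 n p} =
      Nat.card {π : Fin n → ℤ // IsSnake n π} := by
  have : Finite {π : Fin n → ℤ // IsSnake n π} := Finite.of_equiv _ (snakeEquiv n)
  exact ⟨Finite.card_eq.1 (card_wip3_eq_card_snake n), card_wip3_eq_card_snake n⟩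
end

section
/- For every positive integer n, there exists a bijection between the set 𝒮_n of snakes of length n and the set ℜ_n of rc-invariant alternating permutations of {1,…,2n}; in particular |𝒮_n| = |ℜ_n|. -/
/-- `a : Fin N → ℕ` represents a permutation of `{1, …, N}` (written in one-line notation,
positions `0`-indexed): it is injective with values in `{1, …, N}`. -/
def IsPermOn (N : ℕ) (a : Fin N → ℕ) : Prop :=
  Function.Injective a ∧ ∀ i, a i ∈ Finset.Icc 1 N

/-- The down-up (alternating) property `a₁ > a₂ < a₃ > a₄ < ⋯` (positions `0`-indexed). -/
def DownUpN (N : ℕ) (a : Fin N → ℕ) : Prop :=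
  ∀ i : ℕ, ∀ h : i + 1 < N,
    if i % 2 = 0 then a ⟨i + 1, h⟩ < a ⟨i, by omega⟩
    else a ⟨i, by omega⟩ < a ⟨i + 1, h⟩

/-- rc-invariance: `a_{N+1-i} = N+1 - a_i` (in `1`-based positions), i.e. the permutation
equals its reverse-complement. -/
def RCInv (N : ℕ) (a : Fin N → ℕ) : Prop :=
  ∀ i : Fin N, a ⟨N - 1 - (i : ℕ), by have := i.isLt; omega⟩ = N + 1 - a i

/-- An rc-invariant alternating permutation of `{1, …, 2n}`. -/
def IsRCAlt (n : ℕ) (a : Fin (2 * n) → ℕ) : Prop :=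
  IsPermOn (2 * n) a ∧ DownUpN (2 * n) a ∧ RCInv (2 * n) a

/-- Negate `x` exactly when `n` is odd. -/
def paritySign (n : ℕ) (x : ℤ) : ℤ := if n % 2 = 0 then x else -x

/-- The increasing bijection from `{-n, …, -1, 1, …, n}` to `{1, …, 2n}`. -/
def ofSigned (n : ℕ) (x : ℤ) : ℕ := if 0 < x then (x + n).toNat else (x + n + 1).toNat

/-- The increasing bijection from `{1, …, 2n}` to `{-n, …, -1, 1, …, n}`. -/
def toSigned (n k : ℕ) : ℤ := if k ≤ n then (k : ℤ) - n - 1 else (k : ℤ) - n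

/-- The word of length `2n` whose right half is `π` (up to a global sign, and relabelled by
`ofSigned`) and whose left half is forced by rc-invariance. -/
def unfoldSnake (n : ℕ) (π : Fin n → ℤ) (j : Fin (2 * n)) : ℕ :=
  if h : n ≤ (j : ℕ) then ofSigned n (paritySign n (π ⟨j - n, by omega⟩))
  else ofSigned n (-paritySign n (π ⟨n - 1 - j, by omega⟩))

/-- The right half of a word of length `2n`, relabelled by `toSigned`, up to a global sign. -/
def foldRight (n : ℕ) (a : Fin (2 * n) → ℕ) (i : Fin n) : ℤ :=
  paritySign n (toSigned n (a ⟨n + i, by omega⟩))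

theorem isRCAlt_unfoldSnake {n : ℕ} {π : Fin n → ℤ} (hπ : IsSnake n π) :
    IsRCAlt n (unfoldSnake n π) := by
  obtain ⟨⟨hinj, hbd⟩, hpos, hdu⟩ := hπ
  refine ⟨⟨?_, ?_⟩, ?_, ?_⟩
  · intro j k hjk
    have key : ∀ p q : Fin n, (π p).natAbs = (π q).natAbs → (p : ℕ) = q :=
      fun p q h => congrArg Fin.val (hinj h)
    ext
    have hj := j.isLt
    have hk := k.isLt
    by_cases h : n ≤ (j : ℕ) <;> by_cases h' : n ≤ (k : ℕ)
    · have h1 := hbd ⟨j - n, by omega⟩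
      have h2 := hbd ⟨k - n, by omega⟩
      have h3 := key ⟨j - n, by omega⟩ ⟨k - n, by omega⟩
      simp only [unfoldSnake, dif_pos h, dif_pos h', ofSigned, paritySign] at hjk h3
      split_ifs at hjk <;> omega
    · have h1 := hbd ⟨j - n, by omega⟩
      have h2 := hbd ⟨n - 1 - k, by omega⟩
      have h3 := key ⟨j - n, by omega⟩ ⟨n - 1 - k, by omega⟩
      have h4 : j - n = n - 1 - k → π ⟨j - n, by omega⟩ = π ⟨n - 1 - k, by omega⟩ :=
        fun e => by simp only [e]
      simp only [unfoldSnake, dif_pos h, dif_neg h', ofSigned, paritySign] at hjk h3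
      split_ifs at hjk <;> omega
    · have h1 := hbd ⟨n - 1 - j, by omega⟩
      have h2 := hbd ⟨k - n, by omega⟩
      have h3 := key ⟨n - 1 - j, by omega⟩ ⟨k - n, by omega⟩
      have h4 : n - 1 - j = k - n → π ⟨n - 1 - j, by omega⟩ = π ⟨k - n, by omega⟩ :=
        fun e => by simp only [e]
      simp only [unfoldSnake, dif_neg h, dif_pos h', ofSigned, paritySign] at hjk h3
      split_ifs at hjk <;> omega
    · have h1 := hbd ⟨n - 1 - j, by omega⟩
      have h2 := hbd ⟨n - 1 - k, by omega⟩
      have h3 := key ⟨n - 1 - j, by omega⟩ ⟨n - 1 - k, by omega⟩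
      simp only [unfoldSnake, dif_neg h, dif_neg h', ofSigned, paritySign] at hjk h3
      split_ifs at hjk <;> omega
  · intro j
    rw [Finset.mem_Icc]
    unfold unfoldSnake
    split
    · have := hbd ⟨j - n, by omega⟩
      unfold ofSigned paritySign
      split_ifs <;> omega
    · have := hbd ⟨n - 1 - j, by omega⟩
      unfold ofSigned paritySign
      split_ifs <;> omega
  · intro i h
    rcases lt_trichotomy (i + 1) n with hi | hi | hi
    · have h1 := hbd ⟨n - 1 - i, by omega⟩
      have h2 := hbd ⟨n - 1 - (i + 1), by omega⟩
      have h3 := hdu (n - 1 - (i + 1)) (by omega)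
      have e : n - 1 - (i + 1) + 1 = n - 1 - i := by omega
      simp only [e] at h3
      simp only [unfoldSnake, dif_neg (show ¬ n ≤ i by omega),
        dif_neg (show ¬ n ≤ i + 1 by omega), ofSigned, paritySign]
      generalize π ⟨n - 1 - i, _⟩ = x at *
      generalize π ⟨n - 1 - (i + 1), _⟩ = y at *
      split_ifs at h3 ⊢ <;> omega
    · have h1 := hbd ⟨0, by omega⟩
      have h3 := hpos (by omega)
      have e : n - 1 - i = 0 := by omega
      have e' : i + 1 - n = 0 := by omega
      simp only [unfoldSnake, dif_neg (show ¬ n ≤ i by omega),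
        dif_pos (show n ≤ i + 1 by omega), ofSigned, paritySign, e, e']
      generalize π ⟨0, _⟩ = x at *
      split_ifs <;> omega
    · have h1 := hbd ⟨i - n, by omega⟩
      have h2 := hbd ⟨i + 1 - n, by omega⟩
      have h3 := hdu (i - n) (by omega)
      have e : i - n + 1 = i + 1 - n := by omega
      simp only [e] at h3
      simp only [unfoldSnake, dif_pos (show n ≤ i by omega),
        dif_pos (show n ≤ i + 1 by omega), ofSigned, paritySign]
      generalize π ⟨i - n, _⟩ = x at *
      generalize π ⟨i + 1 - n, _⟩ = y at *
      split_ifs at h3 ⊢ <;> omega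
  · intro j
    have hj := j.isLt
    by_cases h : n ≤ (j : ℕ)
    · have h1 := hbd ⟨j - n, by omega⟩
      have e : n - 1 - (2 * n - 1 - (j : ℕ)) = j - n := by omega
      simp only [unfoldSnake, dif_pos h, dif_neg (show ¬ n ≤ 2 * n - 1 - (j : ℕ) by omega),
        ofSigned, paritySign, e]
      generalize π ⟨j - n, _⟩ = x at *
      split_ifs <;> omega
    · have h1 := hbd ⟨n - 1 - j, by omega⟩
      have e : 2 * n - 1 - (j : ℕ) - n = n - 1 - j := by omega
      simp only [unfoldSnake, dif_neg h, dif_pos (show n ≤ 2 * n - 1 - (j : ℕ) by omega),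
        ofSigned, paritySign, e]
      generalize π ⟨n - 1 - j, _⟩ = x at *
      split_ifs <;> omega

theorem IsRCAlt.apply_reflect {n : ℕ} {a : Fin (2 * n) → ℕ} (ha : IsRCAlt n a) {i : ℕ}
    (hi : i < n) :
    a ⟨n - 1 - i, by omega⟩ = 2 * n + 1 - a ⟨n + i, by omega⟩ := by
  rw [← ha.2.2 ⟨n + i, by omega⟩]
  congr 2
  simp only
  omega

theorem isSnake_foldRight {n : ℕ} {a : Fin (2 * n) → ℕ} (ha : IsRCAlt n a) :
    IsSnake n (foldRight n a) := by
  have hrc := fun i hi => ha.apply_reflect (i := i) hi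
  obtain ⟨⟨hinj, hmem⟩, hdu, -⟩ := ha
  have hbd : ∀ j, 1 ≤ a j ∧ a j ≤ 2 * n := fun j => Finset.mem_Icc.mp (hmem j)
  refine ⟨⟨?_, ?_⟩, ?_, ?_⟩
  · intro i j hij
    have hi := i.isLt
    have hj := j.isLt
    have h1 := hbd ⟨n + i, by omega⟩
    have h2 := hbd ⟨n + j, by omega⟩
    have key : a ⟨n + i, by omega⟩ = a ⟨n + j, by omega⟩ ∨
        a ⟨n + i, by omega⟩ = a ⟨n - 1 - j, by omega⟩ := by
      rw [hrc j hj]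
      simp only [foldRight, toSigned, paritySign] at hij
      generalize a ⟨n + i, _⟩ = x at *
      generalize a ⟨n + j, _⟩ = y at *
      split_ifs at hij <;> omega
    rcases key with h | h
    all_goals
      have := congrArg Fin.val (hinj h)
      simp only at this
      omega
  · intro i
    have h1 := hbd ⟨n + i, by omega⟩
    simp only [foldRight, toSigned, paritySign]
    split_ifs <;> omega
  · intro h
    have h1 := hbd ⟨n, by omega⟩
    have h2 := hrc 0 h
    have h3 := hdu (n - 1) (by omega)
    have e : n - 1 + 1 = n := by omega
    simp only [e, Nat.sub_zero, Nat.add_zero] at h2 h3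
    simp only [foldRight, toSigned, paritySign, Nat.add_zero]
    generalize a ⟨n, _⟩ = x at *
    generalize a ⟨n - 1, _⟩ = y at *
    split_ifs at h3 ⊢ <;> omega
  · intro i h
    have h1 := hbd ⟨n + i, by omega⟩
    have h2 := hbd ⟨n + (i + 1), by omega⟩
    have h3 := hdu (n + i) (by omega)
    simp only [Nat.add_assoc] at h3
    simp only [foldRight, toSigned, paritySign]
    generalize a ⟨n + i, _⟩ = x at *
    generalize a ⟨n + (i + 1), _⟩ = y at *
    split_ifs at h3 ⊢ <;> omega

theorem foldRight_unfoldSnake {n : ℕ} {π : Fin n → ℤ} (hπ : IsSnake n π) :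
    foldRight n (unfoldSnake n π) = π := by
  funext i
  have h1 := hπ.1.2 i
  simp only [foldRight, unfoldSnake, dif_pos (Nat.le_add_right n i), Nat.add_sub_cancel_left,
    toSigned, ofSigned, paritySign, Fin.eta]
  split_ifs <;> omega

theorem unfoldSnake_foldRight {n : ℕ} {a : Fin (2 * n) → ℕ} (ha : IsRCAlt n a) :
    unfoldSnake n (foldRight n a) = a := by
  funext j
  have hj := j.isLt
  have hbd : ∀ j, 1 ≤ a j ∧ a j ≤ 2 * n := fun j => Finset.mem_Icc.mp (ha.1.2 j)
  by_cases h : n ≤ (j : ℕ)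
  · have h1 := hbd j
    have e : n + ((j : ℕ) - n) = j := by omega
    simp only [foldRight, unfoldSnake, dif_pos h, e, toSigned, ofSigned, paritySign, Fin.eta]
    split_ifs <;> omega
  · have h1 := hbd ⟨n + (n - 1 - j), by omega⟩
    have h2 := ha.apply_reflect (i := n - 1 - j) (by omega)
    have e : n - 1 - (n - 1 - (j : ℕ)) = j := by omega
    simp only [e, Fin.eta] at h2
    simp only [foldRight, unfoldSnake, dif_neg h, toSigned, ofSigned, paritySign]
    split_ifs <;> omega

/-- Snakes of length `n` correspond to rc-invariant alternating permutations of `{1, …, 2n}`. -/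
def snakeEquivRCAlt (n : ℕ) :
    {π : Fin n → ℤ // IsSnake n π} ≃ {a : Fin (2 * n) → ℕ // IsRCAlt n a} where
  toFun π := ⟨unfoldSnake n π, isRCAlt_unfoldSnake π.2⟩
  invFun a := ⟨foldRight n a, isSnake_foldRight a.2⟩
  left_inv π := Subtype.ext (foldRight_unfoldSnake π.2)
  right_inv a := Subtype.ext (unfoldSnake_foldRight a.2)

/-- For every positive integer `n` there is a bijection between the set
`𝒮ₙ` of snakes of length `n` and the set `ℜₙ` of rc-invariant alternating permutations
of `{1, …, 2n}`; in particular `|𝒮ₙ| = |ℜₙ|`. -/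
theorem snake_equiv_rcAlt (n : ℕ) (hn : 0 < n) :
    Nonempty ({π : Fin n → ℤ // IsSnake n π} ≃ {a : Fin (2 * n) → ℕ // IsRCAlt n a}) ∧
    Nat.card {π : Fin n → ℤ // IsSnake n π} =
      Nat.card {a : Fin (2 * n) → ℕ // IsRCAlt n a} := by
  exact ⟨⟨snakeEquivRCAlt n⟩, Nat.card_congr (snakeEquivRCAlt n)⟩
end

section
/- Let n be a positive integer and let π = π_1⋯π_n be a snake of length n. Define π̃_i = n + π_i if π_i > 0 and π̃_i = n + 1 + π_i if π_i < 0. Define a sequence σ = σ_1⋯σ_{2n} as follows: if n is even, set σ_{n+i} = π̃_i and σ_{n+1−i} = 2n+1 − π̃_i for all i ∈ {1,…,n}; if n is odd, set σ_i = π̃_{n+1−i} and σ_{n+i} = 2n+1 − π̃_i for all i ∈ {1,…,n}. Then σ is an rc-invariant alternating permutation of {1,…,2n}. -/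
/-- If the right half of `σ` is `ρ`, its left half is the reversed complement of `ρ`, and `ρ` is
alternating with the appropriate phase and never takes two complementary values, then `σ` is an
rc-invariant alternating permutation. -/
theorem isRCAlt_of_halves {n : ℕ} {ρ : Fin n → ℕ} {σ : Fin (2 * n) → ℕ}
    (hright : ∀ (i : ℕ) (h : i < n), σ ⟨n + i, by omega⟩ = ρ ⟨i, h⟩)
    (hleft : ∀ (i : ℕ) (h : i < n), σ ⟨n - 1 - i, by omega⟩ = 2 * n + 1 - ρ ⟨i, h⟩)
    (hbound : ∀ i, 1 ≤ ρ i ∧ ρ i ≤ 2 * n)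
    (hinj : Function.Injective ρ)
    (hcompl : ∀ i j, ρ i + ρ j ≠ 2 * n + 1)
    (hzero : ∀ h : 0 < n, if n % 2 = 0 then n + 1 ≤ ρ ⟨0, h⟩ else ρ ⟨0, h⟩ ≤ n)
    (halt : ∀ (i : ℕ) (h : i + 1 < n), if (n + i) % 2 = 0 then ρ ⟨i + 1, h⟩ < ρ ⟨i, by omega⟩
      else ρ ⟨i, by omega⟩ < ρ ⟨i + 1, h⟩) :
    IsRCAlt n σ := by
  have hright' : ∀ (k : ℕ) (h : k < 2 * n) (hk : n ≤ k),
      σ ⟨k, h⟩ = ρ ⟨k - n, by omega⟩ := by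
    intro k h hk
    rw [← hright (k - n) (by omega)]
    congr 2
    omega
  have hleft' : ∀ (k : ℕ) (h : k < 2 * n) (hk : k < n),
      σ ⟨k, h⟩ = 2 * n + 1 - ρ ⟨n - 1 - k, by omega⟩ := by
    intro k h hk
    rw [← hleft (n - 1 - k) (by omega)]
    congr 2
    omega
  refine ⟨⟨?_, ?_⟩, ?_, ?_⟩
  · rintro ⟨a, ha⟩ ⟨b, hb⟩ hab
    rw [Fin.mk.injEq]
    rcases lt_or_ge a n with han | han <;> rcases lt_or_ge b n with hbn | hbn
    · rw [hleft' a ha han, hleft' b hb hbn] at hab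
      have h₁ := hbound ⟨n - 1 - a, by omega⟩
      have h₂ := hbound ⟨n - 1 - b, by omega⟩
      have h := Fin.mk.inj (hinj (show ρ ⟨n - 1 - a, by omega⟩ = ρ ⟨n - 1 - b, by omega⟩ by omega))
      omega
    · rw [hleft' a ha han, hright' b hb hbn] at hab
      have h₁ := hbound ⟨n - 1 - a, by omega⟩
      have h₂ := hcompl ⟨n - 1 - a, by omega⟩ ⟨b - n, by omega⟩
      omega
    · rw [hright' a ha han, hleft' b hb hbn] at hab
      have h₁ := hbound ⟨n - 1 - b, by omega⟩
      have h₂ := hcompl ⟨n - 1 - b, by omega⟩ ⟨a - n, by omega⟩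
      omega
    · rw [hright' a ha han, hright' b hb hbn] at hab
      have h := Fin.mk.inj (hinj hab)
      omega
  · rintro ⟨k, hk⟩
    rw [Finset.mem_Icc]
    rcases lt_or_ge k n with hkn | hkn
    · rw [hleft' k hk hkn]
      have h := hbound ⟨n - 1 - k, by omega⟩
      omega
    · rw [hright' k hk hkn]
      exact hbound _
  · intro k hk
    rcases lt_trichotomy (k + 1) n with hkn | hkn | hkn
    · rw [hleft' k (by omega) (by omega), hleft' (k + 1) hk hkn]
      have h := halt (n - 1 - (k + 1)) (by omega)
      have h₁ := hbound ⟨n - 1 - k, by omega⟩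
      have h₂ := hbound ⟨n - 1 - (k + 1), by omega⟩
      simp only [show n - 1 - (k + 1) + 1 = n - 1 - k by omega] at h
      split_ifs at h ⊢ <;> omega
    · rw [hleft' k (by omega) (by omega), hright' (k + 1) hk hkn.ge]
      have h := hzero (by omega)
      have h₁ := hbound ⟨0, by omega⟩
      simp only [show n - 1 - k = 0 by omega, show k + 1 - n = 0 by omega]
      split_ifs at h ⊢ <;> omega
    · rw [hright' k (by omega) (by omega), hright' (k + 1) hk hkn.le]
      have h := halt (k - n) (by omega)
      simp only [show k - n + 1 = k + 1 - n by omega] at h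
      split_ifs at h ⊢ <;> omega
  · rintro ⟨k, hk⟩
    rcases lt_or_ge k n with hkn | hkn
    · rw [hright' _ _ (by dsimp only; omega), hleft' k hk hkn]
      have h := hbound ⟨n - 1 - k, by omega⟩
      simp only [show 2 * n - 1 - k - n = n - 1 - k by omega]
      omega
    · rw [hleft' _ _ (by dsimp only; omega), hright' k hk hkn]
      simp only [show n - 1 - (2 * n - 1 - k) = k - n by omega]

/-- Let `π` be a snake of length `n`. Define `π̃ᵢ = n + πᵢ` if `πᵢ > 0`
and `π̃ᵢ = n + 1 + πᵢ` if `πᵢ < 0`. Define `σ` on `{1, …, 2n}` by: if `n` is even,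
`σ_{n+i} = π̃ᵢ` and `σ_{n+1-i} = 2n+1 - π̃ᵢ`; if `n` is odd, `σᵢ = π̃_{n+1-i}` and
`σ_{n+i} = 2n+1 - π̃ᵢ` (all positions `1`-based, encoded `0`-based below).
Then `σ` is an rc-invariant alternating permutation of `{1, …, 2n}`. -/
theorem snake_to_rcAlt (n : ℕ) (hn : 0 < n) (π : Fin n → ℤ) (hsnake : IsSnake n π)
    (tilde : Fin n → ℕ)
    (htilde : ∀ i, (tilde i : ℤ) = if 0 < π i then (n : ℤ) + π i else (n : ℤ) + 1 + π i)
    (σ : Fin (2 * n) → ℕ)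
    (heven : Even n → ∀ i : Fin n,
      σ ⟨n + (i : ℕ), by have := i.isLt; omega⟩ = tilde i ∧
      σ ⟨n - 1 - (i : ℕ), by omega⟩ = 2 * n + 1 - tilde i)
    (hodd : Odd n → ∀ i : Fin n,
      σ ⟨(i : ℕ), by have := i.isLt; omega⟩ = tilde ⟨n - 1 - (i : ℕ), by have := i.isLt; omega⟩ ∧
      σ ⟨n + (i : ℕ), by have := i.isLt; omega⟩ = 2 * n + 1 - tilde i) :
    IsRCAlt n σ := by
  obtain ⟨⟨hπinj, hπ⟩, hpos, hdu⟩ := hsnake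
  have hbound : ∀ i, 1 ≤ tilde i ∧ tilde i ≤ 2 * n := by
    intro i
    have h := htilde i
    have h' := hπ i
    split_ifs at h <;> omega
  have hmono : ∀ i j, π i < π j → tilde i < tilde j := by
    intro i j hij
    have h₁ := htilde i
    have h₂ := htilde j
    have h₃ := hπ i
    have h₄ := hπ j
    split_ifs at h₁ h₂ <;> omega
  have hinj : Function.Injective tilde := by
    intro i j hij
    refine hπinj (congrArg Int.natAbs ?_)
    by_contra hne
    rcases lt_or_gt_of_ne hne with h | h
    · exact (hmono i j h).ne hij
    · exact (hmono j i h).ne' hij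
  have hcompl : ∀ i j, tilde i + tilde j ≠ 2 * n + 1 := by
    intro i j hij
    have h₁ := htilde i
    have h₂ := htilde j
    have h₃ := hπ i
    have h₄ := hπ j
    have habs : (π i).natAbs = (π j).natAbs := by split_ifs at h₁ h₂ <;> omega
    obtain rfl := hπinj habs
    omega
  have hzero : n + 1 ≤ tilde ⟨0, hn⟩ := by
    have h := htilde ⟨0, hn⟩
    have h' := hpos hn
    rw [if_pos h'] at h
    omega
  have halt : DownUpN n tilde := by
    intro i h
    have h' := hdu i h
    split_ifs at h' ⊢ <;> exact hmono _ _ h'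
  rcases Nat.even_or_odd n with he | ho
  · have hn2 := Nat.even_iff.mp he
    refine isRCAlt_of_halves (ρ := tilde) (fun i h => (heven he ⟨i, h⟩).1)
      (fun i h => (heven he ⟨i, h⟩).2) hbound hinj hcompl (fun _ => ?_) (fun i h => ?_)
    · rwa [if_pos hn2]
    · have h' := halt i h
      rwa [show (n + i) % 2 = i % 2 by omega]
  · have hn2 := Nat.odd_iff.mp ho
    refine isRCAlt_of_halves (ρ := fun i => 2 * n + 1 - tilde i) (fun i h => (hodd ho ⟨i, h⟩).2)
      (fun i h => ?_) (fun i => ?_) (fun i j hij => ?_) (fun i j => ?_) (fun _ => ?_)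
      (fun i h => ?_)
    · have h' := hbound ⟨i, h⟩
      rw [(hodd ho ⟨n - 1 - i, by omega⟩).1]
      simp only [show n - 1 - (n - 1 - i) = i by omega]
      omega
    · have h' := hbound i
      omega
    · have h₁ := hbound i
      have h₂ := hbound j
      dsimp only at hij
      exact hinj (by omega)
    · have h₁ := hbound i
      have h₂ := hbound j
      have h₃ := hcompl i j
      omega
    · rw [if_neg (by omega)]
      omega
    · have h' := halt i h
      have h₁ := hbound ⟨i, by omega⟩
      have h₂ := hbound ⟨i + 1, h⟩
      split_ifs at h' ⊢ <;> omega
end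

section
/- Let π be a permutation of {1,…,n}, adopt the conventions π_0 = 0 and π_{n+1} = n+1, and let i ∈ {1,…,n} with j = π^{-1}(i). Then (31-2)_i(π) + (2-31)_i(π) = #{k ∈ {0,1,…,n} : k ≠ j and π_{k+1} < i ≤ π_k}. -/
/-- Let `π` be a permutation of `{1, …, n}` (here given by its extended
one-line word `A : ℕ → ℕ` with the conventions `A 0 = 0` and `A (n+1) = n+1`, and `A`
a bijection of `{1, …, n}` onto itself), let `i ∈ {1, …, n}` and let `j = π⁻¹(i)`.
Then `(31-2)ᵢ(π) + (2-31)ᵢ(π) = #{k ∈ {0, 1, …, n} : k ≠ j ∧ A (k+1) < i ≤ A k}`,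
where `(31-2)ᵢ(π) = #{k : 1 ≤ k < j, A k < i < A (k-1)}` and
`(2-31)ᵢ(π) = #{k : j < k ≤ n, A (k+1) < i < A k}`. -/
theorem pattern_count_sum (n : ℕ) (hn : 0 < n) (A : ℕ → ℕ)
    (hA0 : A 0 = 0) (hAtop : A (n + 1) = n + 1)
    (hmem : ∀ k ∈ Finset.Icc 1 n, A k ∈ Finset.Icc 1 n)
    (hinj : Set.InjOn A (Set.Icc 1 n))
    (i j : ℕ) (hi : i ∈ Finset.Icc 1 n) (hj : j ∈ Finset.Icc 1 n) (hji : A j = i) :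
    ((Finset.Ico 1 j).filter (fun k => A k < i ∧ i < A (k - 1))).card
      + ((Finset.Ioc j n).filter (fun k => A (k + 1) < i ∧ i < A k)).card
    = ((Finset.Icc 0 n).filter (fun k => k ≠ j ∧ A (k + 1) < i ∧ i ≤ A k)).card := by
  simp only [Finset.mem_Icc] at hi hj hmem
  have hne : ∀ k ≤ n, k ≠ j → A k ≠ i := by
    intro k hk hkj h
    rcases Nat.eq_zero_or_pos k with rfl | hpos
    · omega
    · exact hkj (hinj ⟨hpos, hk⟩ hj (h.trans hji.symm))
  have hshift : ((Finset.Ico 1 j).filter (fun k => A k < i ∧ i < A (k - 1))).card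
      = ((Finset.range j).filter (fun k => A (k + 1) < i ∧ i < A k)).card := by
    refine Finset.card_bij' (fun k _ => k - 1) (fun k _ => k + 1) ?_ ?_ ?_ ?_
    · intro k hk
      simp only [Finset.mem_filter, Finset.mem_Ico, Finset.mem_range] at hk ⊢
      rw [Nat.sub_add_cancel hk.1.1]
      exact ⟨by omega, hk.2⟩
    · intro k hk
      simp only [Finset.mem_filter, Finset.mem_Ico, Finset.mem_range] at hk ⊢
      have : k + 1 ≠ j := by
        rintro rfl
        omega
      exact ⟨by omega, hk.2⟩
    · intro k hk
      simp only [Finset.mem_filter, Finset.mem_Ico] at hk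
      exact Nat.sub_add_cancel hk.1.1
    · intro k _
      exact Nat.add_sub_cancel k 1
  have hdisj : Disjoint ((Finset.range j).filter (fun k => A (k + 1) < i ∧ i < A k))
      ((Finset.Ioc j n).filter (fun k => A (k + 1) < i ∧ i < A k)) := by
    refine Finset.disjoint_filter_filter (Finset.disjoint_left.2 fun k hk hk' => ?_)
    simp only [Finset.mem_range, Finset.mem_Ioc] at hk hk'
    omega
  rw [hshift, ← Finset.card_union_of_disjoint hdisj]
  congr 1
  ext k
  simp only [Finset.mem_union, Finset.mem_filter, Finset.mem_range, Finset.mem_Ioc,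
    Finset.mem_Icc]
  have := hne k
  omega
end

section
/- For every positive integer n, there exists a bijection between the set ℜ_n of rc-invariant alternating permutations of {1,…,2n} and the set 𝒫_n of labeled ballot paths of length n; in particular |ℜ_n| = |𝒫_n|. -/
/-- Number of up steps among the first `i` steps of `p` (`true` = up `U`). -/
def upCount (n : ℕ) (p : Fin n → Bool) (i : ℕ) : ℕ :=
  (Finset.univ.filter (fun j : Fin n => (j : ℕ) < i ∧ p j = true)).card

/-- Number of down steps among the first `i` steps of `p` (`false` = down `D`). -/
def downCount (n : ℕ) (p : Fin n → Bool) (i : ℕ) : ℕ :=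
  (Finset.univ.filter (fun j : Fin n => (j : ℕ) < i ∧ p j = false)).card

/-- A ballot path: every prefix has at least as many up steps as down steps. -/
def IsBallot (n : ℕ) (p : Fin n → Bool) : Prop :=
  ∀ i ≤ n, downCount n p i ≤ upCount n p i

/-- A labeled ballot path `(P, w)`: a ballot path together with labels satisfying
`0 ≤ wᵢ ≤ hᵢ(P)` for up steps and `0 ≤ wᵢ ≤ hᵢ(P) - 1` for down steps, where
`hᵢ(P) = upCount - downCount` is the height of the `i`-th step. -/
def IsLBP (n : ℕ) (pw : (Fin n → Bool) × (Fin n → ℕ)) : Prop :=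
  IsBallot n pw.1 ∧
  ∀ i : Fin n,
    if pw.1 i then pw.2 i + downCount n pw.1 i ≤ upCount n pw.1 i
    else pw.2 i + 1 + downCount n pw.1 i ≤ upCount n pw.1 i

/-- Two consecutive signed labels are compatible when each negative one sits next to a positive
one of smaller absolute value. -/
def Compatible (x y : ℤ) : Prop :=
  (x < 0 → 0 < y ∧ y < -x) ∧ (y < 0 → 0 < x ∧ x < -y)

instance : DecidableRel Compatible := fun _ _ => inferInstanceAs (Decidable (_ ∧ _))

/-- A signed permutation of `{1, …, n}` with compatible neighbours; the leading `0` forces the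
first entry to be positive. -/
def IsCompatibleWord (n : ℕ) (l : List ℤ) : Prop :=
  (l.map Int.natAbs).Perm (List.range' 1 n) ∧ (0 :: l).IsChain Compatible

/-- The label of absolute value `N`, positive for an up step and negative for a down step. -/
def signedLabel (b : Bool) (N : ℤ) : ℤ := if b then N else -N

theorem natAbs_signedLabel (b : Bool) (N : ℕ) : (signedLabel b N).natAbs = N := by
  cases b <;> simp [signedLabel]

theorem signedLabel_injective {N : ℤ} (hN : 0 < N) {b c : Bool}
    (h : signedLabel b N = signedLabel c N) : b = c := by
  cases b <;> cases c <;> simp [signedLabel] at h ⊢ <;> omega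

/-- The positions at which a new largest label can be inserted into the word `l`, which is
preceded by `s`. -/
def insertionPositions (s a : ℤ) (l : List ℤ) : Finset ℕ :=
  (Finset.range (l.length + 1)).filter fun i => (s :: l.insertIdx i a).IsChain Compatible

theorem card_insertionPositions_cons (s a y : ℤ) (l : List ℤ) (hsy : Compatible s y) :
    (insertionPositions s a (y :: l)).card = (insertionPositions y a l).card +
      if (s :: a :: y :: l).IsChain Compatible then 1 else 0 := by
  simp only [insertionPositions, Finset.card_filter]
  rw [List.length_cons, Finset.sum_range_succ' _ (l.length + 1)]
  simp [-Finset.sum_boole, hsy]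

theorem card_insertionPositions_pos (N : ℤ) (l : List ℤ) (hl : ∀ x ∈ l, x ≠ 0 ∧ |x| < N)
    (hN : 0 < N) (s : ℤ) (hs : |s| < N) (hc : (s :: l).IsChain Compatible) :
    ((insertionPositions s N l).card : ℤ) = (l.map Int.sign).sum + if 0 ≤ s then 1 else 0 := by
  induction l generalizing s with
  | nil =>
    have : Compatible s N ↔ 0 ≤ s := by
      unfold Compatible; rw [abs_lt] at hs; omega
    simp only [insertionPositions, Finset.card_filter]
    simp [-Finset.sum_boole, this]
  | cons y l ih =>
    obtain ⟨hsy, hyl⟩ := List.isChain_cons_cons.1 hc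
    obtain ⟨hy0, hyN⟩ := hl y (by simp)
    rw [card_insertionPositions_cons _ _ _ _ hsy]
    push_cast
    rw [ih (fun x hx => hl x (by simp [hx])) y hyN hyl]
    have : (s :: N :: y :: l).IsChain Compatible ↔ 0 ≤ s ∧ 0 < y := by
      rw [List.isChain_cons_cons, List.isChain_cons_cons]
      simp only [hyl, and_true]
      unfold Compatible; rw [abs_lt] at hs hyN; omega
    simp only [this, List.map_cons, List.sum_cons]
    unfold Compatible at hsy
    rcases lt_or_gt_of_ne hy0 with h | h
    · rw [Int.sign_eq_neg_one_of_neg h]; split_ifs <;> omega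
    · rw [Int.sign_eq_one_of_pos h]; split_ifs <;> omega

theorem card_insertionPositions_neg (N : ℤ) (l : List ℤ) (hl : ∀ x ∈ l, x ≠ 0 ∧ |x| < N)
    (hN : 0 < N) (s : ℤ) (hs : |s| < N) (hc : (s :: l).IsChain Compatible) :
    ((insertionPositions s (-N) l).card : ℤ) =
      (l.map Int.sign).sum + if 0 < s then 1 else 0 := by
  induction l generalizing s with
  | nil =>
    have : Compatible s (-N) ↔ 0 < s := by
      unfold Compatible; rw [abs_lt] at hs; omega
    simp only [insertionPositions, Finset.card_filter]
    simp [-Finset.sum_boole, this]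
  | cons y l ih =>
    obtain ⟨hsy, hyl⟩ := List.isChain_cons_cons.1 hc
    obtain ⟨hy0, hyN⟩ := hl y (by simp)
    rw [card_insertionPositions_cons _ _ _ _ hsy]
    push_cast
    rw [ih (fun x hx => hl x (by simp [hx])) y hyN hyl]
    have : (s :: -N :: y :: l).IsChain Compatible ↔ 0 < s ∧ 0 < y := by
      rw [List.isChain_cons_cons, List.isChain_cons_cons]
      simp only [hyl, and_true]
      unfold Compatible; rw [abs_lt] at hs hyN; omega
    simp only [this, List.map_cons, List.sum_cons]
    unfold Compatible at hsy
    rcases lt_or_gt_of_ne hy0 with h | h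
    · rw [Int.sign_eq_neg_one_of_neg h]; split_ifs <;> omega
    · rw [Int.sign_eq_one_of_pos h]; split_ifs <;> omega

theorem IsCompatibleWord.ne_zero_and_abs_lt {n : ℕ} {l : List ℤ} (h : IsCompatibleWord n l) :
    ∀ x ∈ l, x ≠ 0 ∧ |x| < (n : ℤ) + 1 := by
  intro x hx
  have := h.1.subset (List.mem_map_of_mem hx)
  rw [List.mem_range'_1] at this
  rw [Int.abs_eq_natAbs]
  omega

theorem IsCompatibleWord.card_insertionPositions {n : ℕ} {l : List ℤ} (h : IsCompatibleWord n l)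
    (b : Bool) : ((insertionPositions 0 (signedLabel b ((n : ℤ) + 1)) l).card : ℤ) =
      (l.map Int.sign).sum + if b then 1 else 0 := by
  cases b
  · simpa [signedLabel] using card_insertionPositions_neg (n + 1) l h.ne_zero_and_abs_lt
      (by omega) 0 (by rw [abs_zero]; omega) h.2
  · simpa [signedLabel] using card_insertionPositions_pos (n + 1) l h.ne_zero_and_abs_lt
      (by omega) 0 (by rw [abs_zero]; omega) h.2

theorem isChain_compatible_of_insert {b : Bool} {N : ℤ} (l₁ l₂ : List ℤ)
    (hl : ∀ x ∈ l₁ ++ l₂, x ≠ 0 ∧ |x| < N) (s : ℤ) (hs : |s| < N)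
    (hc : (s :: (l₁ ++ signedLabel b N :: l₂)).IsChain Compatible) :
    (s :: (l₁ ++ l₂)).IsChain Compatible := by
  induction l₁ generalizing s with
  | nil =>
    cases l₂ with
    | nil => simp
    | cons y l =>
      have hy := hl y (by simp)
      simp only [List.nil_append, List.isChain_cons_cons] at hc ⊢
      refine ⟨?_, hc.2.2⟩
      have h1 := hc.1
      have h2 := hc.2.1
      rw [abs_lt] at hs hy
      unfold Compatible at *
      cases b <;> simp [signedLabel] at h1 h2 <;> omega
  | cons y l ih =>
    simp only [List.cons_append, List.isChain_cons_cons] at hc ⊢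
    exact ⟨hc.1, ih (fun x hx => hl x (by simp at hx ⊢; tauto)) y (hl y (by simp)).2 hc.2⟩

theorem IsCompatibleWord.insertIdx {n : ℕ} {l : List ℤ} (h : IsCompatibleWord n l) {b : Bool}
    {i : ℕ} (hi : i ∈ insertionPositions 0 (signedLabel b ((n : ℤ) + 1)) l) :
    IsCompatibleWord (n + 1) (l.insertIdx i (signedLabel b ((n : ℤ) + 1))) := by
  simp only [insertionPositions, Finset.mem_filter, Finset.mem_range] at hi
  refine ⟨?_, hi.2⟩
  have := (List.perm_insertIdx (signedLabel b ((n : ℤ) + 1)) l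
    (Nat.lt_succ_iff.1 hi.1)).map Int.natAbs
  refine this.trans ?_
  rw [List.map_cons, List.range'_concat, show (n : ℤ) + 1 = ((n + 1 : ℕ) : ℤ) by simp,
    natAbs_signedLabel]
  refine (h.1.cons (n + 1)).trans ?_
  rw [one_mul, add_comm 1]
  exact (List.perm_append_singleton _ _).symm

/-- Inserting the largest label into a compatible word, as a map from all possible choices. -/
def insertLabel (n : ℕ) (x : Σ l : {l : List ℤ // IsCompatibleWord n l}, Σ b : Bool,
    insertionPositions 0 (signedLabel b ((n : ℤ) + 1)) l.1) :
    {l : List ℤ // IsCompatibleWord (n + 1) l} :=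
  ⟨x.1.1.insertIdx x.2.2.1 (signedLabel x.2.1 ((n : ℤ) + 1)), x.1.2.insertIdx x.2.2.2⟩

theorem sum_sign_insertLabel (n : ℕ) (x) : ((insertLabel n x).1.map Int.sign).sum =
    (x.1.1.map Int.sign).sum + if x.2.1 then 1 else -1 := by
  obtain ⟨l, b, i, hi⟩ := x
  simp only [insertionPositions, Finset.mem_filter, Finset.mem_range] at hi
  have := ((List.perm_insertIdx (signedLabel b ((n : ℤ) + 1)) l.1
    (Nat.lt_succ_iff.1 hi.1)).map Int.sign).sum_eq
  simp only [insertLabel, this, List.map_cons, List.sum_cons]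
  cases b
  · simp [signedLabel, Int.sign_eq_neg_one_of_neg (show -1 + -(n : ℤ) < 0 by omega)]; omega
  · simp [signedLabel, Int.sign_eq_one_of_pos (show (n : ℤ) + 1 > 0 by omega)]; omega

theorem erase_insertIdx_of_notMem {α : Type*} [DecidableEq α] {a : α} {l : List α} (ha : a ∉ l)
    {i : ℕ} (hi : i ≤ l.length) : (l.insertIdx i a).erase a = l := by
  induction l generalizing i with
  | nil => simp_all
  | cons y l ih =>
    cases i with
    | zero => simp
    | succ i =>
      rw [List.mem_cons, not_or] at ha
      rw [List.insertIdx_succ_cons, List.erase_cons_tail (by simpa using Ne.symm ha.1),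
        ih ha.2 (by simpa using hi)]

theorem insertLabel_bijective (n : ℕ) : Function.Bijective (insertLabel n) := by
  constructor
  · rintro ⟨⟨l, hl⟩, b, i, hi⟩ ⟨⟨m, hm⟩, c, j, hj⟩ h
    have hi' := hi
    have hj' := hj
    simp only [insertionPositions, Finset.mem_filter, Finset.mem_range, Nat.lt_succ_iff]
      at hi' hj'
    simp only [insertLabel, Subtype.mk.injEq] at h
    have hnot : ∀ {l : List ℤ} (b : Bool), IsCompatibleWord n l →
        signedLabel b ((n : ℤ) + 1) ∉ l := by
      intro l b hl hmem
      have := (hl.ne_zero_and_abs_lt _ hmem).2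
      rw [abs_lt] at this
      cases b <;> simp [signedLabel] at this
    have hbc : b = c := by
      have hmem : signedLabel b ((n : ℤ) + 1) ∈ m.insertIdx j (signedLabel c ((n : ℤ) + 1)) := by
        rw [← h]; exact (List.mem_insertIdx hi'.1).2 (Or.inl rfl)
      rcases (List.mem_insertIdx hj'.1).1 hmem with h' | h'
      · exact signedLabel_injective (by omega) h'
      · exact absurd h' (hnot b hm)
    subst hbc
    have hlm : l = m := by
      rw [← erase_insertIdx_of_notMem (hnot b hl) hi'.1, h,
        erase_insertIdx_of_notMem (hnot b hm) hj'.1]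
    subst hlm
    have hij := List.injOn_insertIdx_index_of_notMem l _ (hnot b hl) hi'.1 hj'.1 h
    subst hij
    rfl
  · rintro ⟨l, hl⟩
    have hmem : n + 1 ∈ l.map Int.natAbs := hl.1.symm.subset (by simp)
    obtain ⟨a, ha, han⟩ := List.mem_map.1 hmem
    obtain ⟨b, rfl⟩ : ∃ b, a = signedLabel b ((n : ℤ) + 1) := by
      rcases lt_or_ge a 0 with h | h
      · exact ⟨false, by simp [signedLabel]; omega⟩
      · exact ⟨true, by simp [signedLabel]; omega⟩
    obtain ⟨l₁, l₂, rfl⟩ := List.append_of_mem ha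
    have hperm : ((l₁ ++ l₂).map Int.natAbs).Perm (List.range' 1 n) := by
      have h1 := (List.perm_middle (a := signedLabel b ((n : ℤ) + 1)) (l₁ := l₁)
        (l₂ := l₂)).map Int.natAbs
      have h2 := h1.symm.trans hl.1
      rw [List.map_cons, han, List.range'_concat, mul_comm, mul_one, add_comm 1 n] at h2
      exact (h2.trans (List.perm_append_singleton _ _)).cons_inv
    have hb : ∀ x ∈ l₁ ++ l₂, x ≠ 0 ∧ |x| < (n : ℤ) + 1 := by
      intro x hx
      have := hperm.subset (List.mem_map_of_mem hx)
      rw [List.mem_range'_1] at this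
      rw [Int.abs_eq_natAbs]
      omega
    have hins : (l₁ ++ l₂).insertIdx l₁.length (signedLabel b ((n : ℤ) + 1)) =
        l₁ ++ signedLabel b ((n : ℤ) + 1) :: l₂ := by
      clear * -
      induction l₁ <;> simp_all
    refine ⟨⟨⟨l₁ ++ l₂, hperm, isChain_compatible_of_insert l₁ l₂ hb 0 (by rw [abs_zero]; omega) hl.2⟩,
      b, l₁.length, ?_⟩, Subtype.ext hins⟩
    simp only [insertionPositions, Finset.mem_filter, Finset.mem_range]
    exact ⟨by simp, by rw [hins]; exact hl.2⟩

theorem upCount_snoc_of_le {n : ℕ} (p : Fin n → Bool) (b : Bool) {i : ℕ} (hi : i ≤ n) :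
    upCount (n + 1) (Fin.snoc p b : Fin (n + 1) → Bool) i = upCount n p i := by
  simp only [upCount, Finset.card_filter]
  rw [Fin.sum_univ_castSucc]
  simp [-Finset.sum_boole, hi]

theorem downCount_snoc_of_le {n : ℕ} (p : Fin n → Bool) (b : Bool) {i : ℕ} (hi : i ≤ n) :
    downCount (n + 1) (Fin.snoc p b : Fin (n + 1) → Bool) i = downCount n p i := by
  simp only [downCount, Finset.card_filter]
  rw [Fin.sum_univ_castSucc]
  simp [-Finset.sum_boole, hi]

theorem upCount_snoc_succ {n : ℕ} (p : Fin n → Bool) (b : Bool) :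
    upCount (n + 1) (Fin.snoc p b : Fin (n + 1) → Bool) (n + 1) =
      upCount n p n + if b then 1 else 0 := by
  simp only [upCount, Finset.card_filter]
  rw [Fin.sum_univ_castSucc]
  simp [-Finset.sum_boole, fun j : Fin n => j.2.trans (Nat.lt_succ_self n)]

theorem downCount_snoc_succ {n : ℕ} (p : Fin n → Bool) (b : Bool) :
    downCount (n + 1) (Fin.snoc p b : Fin (n + 1) → Bool) (n + 1) =
      downCount n p n + if b then 0 else 1 := by
  simp only [downCount, Finset.card_filter]
  rw [Fin.sum_univ_castSucc]
  cases b <;> simp [-Finset.sum_boole, fun j : Fin n => j.2.trans (Nat.lt_succ_self n)]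

/-- The final height of a path. -/
def finalHeight (n : ℕ) (p : Fin n → Bool) : ℤ := upCount n p n - downCount n p n

theorem finalHeight_snoc {n : ℕ} (p : Fin n → Bool) (b : Bool) :
    finalHeight (n + 1) (Fin.snoc p b : Fin (n + 1) → Bool) =
      finalHeight n p + if b then 1 else -1 := by
  simp only [finalHeight, upCount_snoc_succ, downCount_snoc_succ]
  cases b <;> simp <;> omega

/-- Appending a labelled step to a labelled path. -/
def snocStep {n : ℕ} (pw : (Fin n → Bool) × (Fin n → ℕ)) (b : Bool) (k : ℕ) :
    (Fin (n + 1) → Bool) × (Fin (n + 1) → ℕ) :=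
  (Fin.snoc pw.1 b, Fin.snoc pw.2 k)

theorem isLBP_snocStep {n : ℕ} (pw : (Fin n → Bool) × (Fin n → ℕ)) (b : Bool) (k : ℕ) :
    IsLBP (n + 1) (snocStep pw b k) ↔
      IsLBP n pw ∧ (k : ℤ) < finalHeight n pw.1 + if b then 1 else 0 := by
  have hlabels : (∀ i : Fin (n + 1), if (snocStep pw b k).1 i then
        (snocStep pw b k).2 i + downCount (n + 1) (snocStep pw b k).1 i ≤
          upCount (n + 1) (snocStep pw b k).1 i
      else (snocStep pw b k).2 i + 1 + downCount (n + 1) (snocStep pw b k).1 i ≤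
          upCount (n + 1) (snocStep pw b k).1 i) ↔
      (∀ i : Fin n, if pw.1 i then pw.2 i + downCount n pw.1 i ≤ upCount n pw.1 i
        else pw.2 i + 1 + downCount n pw.1 i ≤ upCount n pw.1 i) ∧
      (k : ℤ) < finalHeight n pw.1 + if b then 1 else 0 := by
    rw [Fin.forall_fin_succ']
    refine and_congr (forall_congr' fun i => ?_) ?_
    · simp [snocStep, upCount_snoc_of_le _ _ i.2.le, downCount_snoc_of_le _ _ i.2.le]
    · simp only [snocStep, Fin.snoc_last, Fin.val_last, upCount_snoc_of_le _ _ le_rfl,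
        downCount_snoc_of_le _ _ le_rfl, finalHeight]
      cases b <;> simp <;> omega
  have hballot : IsBallot (n + 1) (snocStep pw b k).1 ↔ IsBallot n pw.1 ∧
      downCount n pw.1 n + (if b then 0 else 1) ≤ upCount n pw.1 n + if b then 1 else 0 := by
    rw [← upCount_snoc_succ, ← downCount_snoc_succ]
    constructor
    · intro h
      refine ⟨fun i hi => ?_, h _ le_rfl⟩
      simpa [snocStep, upCount_snoc_of_le _ _ hi, downCount_snoc_of_le _ _ hi]
        using h i (by omega)
    · rintro ⟨h, h'⟩ i hi
      rcases Nat.lt_succ_iff_lt_or_eq.1 (Nat.lt_succ_of_le hi) with hi | rfl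
      · have hi := Nat.le_of_lt_succ hi
        simpa [snocStep, upCount_snoc_of_le _ _ hi, downCount_snoc_of_le _ _ hi] using h i hi
      · exact h'
  unfold IsLBP
  rw [hlabels, hballot]
  unfold finalHeight
  constructor
  · tauto
  · rintro ⟨⟨h1, h2⟩, h3⟩
    refine ⟨⟨h1, ?_⟩, h2, h3⟩
    cases b <;> simp at h3 ⊢ <;> omega

/-- Extending a labelled ballot path by one step, as a map from all possible choices. -/
def extendPath (n : ℕ) (x : Σ pw : {pw : (Fin n → Bool) × (Fin n → ℕ) // IsLBP n pw}, Σ b : Bool,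
    Finset.range (finalHeight n pw.1.1 + if b then 1 else 0).toNat) :
    {pw : (Fin (n + 1) → Bool) × (Fin (n + 1) → ℕ) // IsLBP (n + 1) pw} :=
  ⟨snocStep x.1.1 x.2.1 x.2.2.1, (isLBP_snocStep _ _ _).2
    ⟨x.1.2, Int.lt_toNat.1 (Finset.mem_range.1 x.2.2.2)⟩⟩

theorem extendPath_bijective (n : ℕ) : Function.Bijective (extendPath n) := by
  constructor
  · rintro ⟨⟨⟨p, w⟩, hpw⟩, b, i, hi⟩ ⟨⟨⟨q, v⟩, hqv⟩, c, j, hj⟩ h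
    simp only [extendPath, snocStep, Subtype.mk.injEq, Prod.mk.injEq] at h
    obtain ⟨rfl, rfl⟩ := Fin.snoc_injective2 h.1
    obtain ⟨rfl, rfl⟩ := Fin.snoc_injective2 h.2
    rfl
  · rintro ⟨⟨p, w⟩, h⟩
    have heq : snocStep (Fin.init p, Fin.init w) (p (Fin.last n)) (w (Fin.last n)) = (p, w) := by
      simp [snocStep]
    have h' := (isLBP_snocStep _ _ _).1 (heq ▸ h)
    exact ⟨⟨⟨_, h'.1⟩, _, ⟨_, Finset.mem_range.2 (Int.lt_toNat.2 h'.2)⟩⟩, Subtype.ext heq⟩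

theorem exists_equiv_compatibleWord_lbp (n : ℕ) :
    ∃ e : {l : List ℤ // IsCompatibleWord n l} ≃
        {pw : (Fin n → Bool) × (Fin n → ℕ) // IsLBP n pw},
      ∀ l, finalHeight n (e l).1.1 = (l.1.map Int.sign).sum := by
  induction n with
  | zero =>
    have hnil : ∀ l : List ℤ, IsCompatibleWord 0 l ↔ l = [] := by
      intro l
      constructor
      · intro h
        simpa using h.1.length_eq
      · rintro rfl
        simp [IsCompatibleWord]
    have hlbp : ∀ pw, IsLBP 0 pw := fun pw =>
      ⟨fun i _ => by simp [downCount], fun i => i.elim0⟩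
    refine ⟨⟨fun _ => ⟨default, hlbp _⟩, fun _ => ⟨[], (hnil _).2 rfl⟩, fun l => ?_,
      fun pw => Subtype.ext (Subsingleton.elim _ _)⟩, fun l => ?_⟩
    · exact Subtype.ext ((hnil _).1 l.2).symm
    · simp [(hnil _).1 l.2, finalHeight, upCount, downCount]
  | succ n ih =>
    obtain ⟨e, he⟩ := ih
    let f := Equiv.sigmaCongr
      (β₁ := fun l => Σ b : Bool, insertionPositions 0 (signedLabel b ((n : ℤ) + 1)) l.1)
      (β₂ := fun pw => Σ b : Bool,
        Finset.range (finalHeight n pw.1.1 + if b then 1 else 0).toNat) e fun l => Equiv.sigmaCongrRight fun b =>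
      Finset.equivOfCardEq (s := insertionPositions 0 (signedLabel b ((n : ℤ) + 1)) l.1)
        (t := Finset.range (finalHeight n (e l).1.1 + if b then 1 else 0).toNat) (by
          rw [Finset.card_range, he, ← l.2.card_insertionPositions b, Int.toNat_natCast])
    refine ⟨(Equiv.ofBijective _ (insertLabel_bijective n)).symm.trans
      (f.trans (Equiv.ofBijective _ (extendPath_bijective n))), fun l => ?_⟩
    obtain ⟨x, rfl⟩ := (Equiv.ofBijective _ (insertLabel_bijective n)).surjective l
    rw [Equiv.trans_apply, Equiv.symm_apply_apply]
    refine Eq.trans ?_ (sum_sign_insertLabel n x).symm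
    rw [← he]
    exact finalHeight_snoc _ _

theorem isCompatibleWord_ofFn {n : ℕ} (e : Fin n → ℤ) : IsCompatibleWord n (List.ofFn e) ↔
    Function.Injective (fun i => (e i).natAbs) ∧ (∀ i, e i ≠ 0 ∧ (e i).natAbs ≤ n) ∧
    (∀ h : 0 < n, 0 < e ⟨0, h⟩) ∧
    ∀ i, ∀ h : i + 1 < n, Compatible (e ⟨i, by omega⟩) (e ⟨i + 1, h⟩) := by
  have hperm : ((List.ofFn e).map Int.natAbs).Perm (List.range' 1 n) ↔
      Function.Injective (fun i => (e i).natAbs) ∧ ∀ i, e i ≠ 0 ∧ (e i).natAbs ≤ n := by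
    rw [List.map_ofFn]
    constructor
    · intro h
      refine ⟨List.nodup_ofFn.1 (h.nodup_iff.2 List.nodup_range'), fun i => ?_⟩
      have := h.subset (List.mem_ofFn.2 ⟨i, rfl⟩)
      simp only [Function.comp, List.mem_range'_1] at this
      omega
    · rintro ⟨h1, h2⟩
      refine (List.Nodup.subperm (List.nodup_ofFn.2 h1) fun x hx => ?_).perm_of_length_le
        (by simp)
      obtain ⟨i, rfl⟩ := List.mem_ofFn.1 hx
      have := h2 i
      simp only [List.mem_range'_1]
      omega
  rw [IsCompatibleWord, hperm, List.isChain_cons, List.isChain_ofFn, and_assoc]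
  refine and_congr_right fun _ => and_congr_right fun h => and_congr_left fun _ => ?_
  cases n with
  | zero => simp
  | succ n =>
    have := (h 0).1
    simp only [List.ofFn_succ, List.head?_cons, Option.mem_def, Option.some.injEq,
      forall_eq', Compatible, Nat.succ_pos, forall_true_left]
    change _ ↔ 0 < e 0
    omega

/-- The signed label of a value in `{1, …, 2n}`: the values above `n` become positive, and larger
distance from the centre means smaller absolute value. -/
def centredLabel (n v : ℕ) : ℤ := if n < v then 2 * n + 1 - v else -v

/-- The even one of the two central positions at distance `i` from the centre. -/
def peakPosition (n : ℕ) (i : Fin n) : Fin (2 * n) :=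
  ⟨if (n + i) % 2 = 0 then n + i else n - 1 - i, by have := i.2; split_ifs <;> omega⟩

theorem peakPosition_val (n : ℕ) (i : Fin n) : (peakPosition n i : ℕ) =
    if (n + i) % 2 = 0 then n + i else n - 1 - i := rfl

theorem IsRCAlt.add_peakPosition_ne {n : ℕ} {a : Fin (2 * n) → ℕ} (ha : IsRCAlt n a)
    (i j : Fin n) : a (peakPosition n i) + a (peakPosition n j) ≠ 2 * n + 1 := by
  intro h
  have hrc := ha.2.2 (peakPosition n i)
  rw [show 2 * n + 1 - a (peakPosition n i) = a (peakPosition n j) by omega] at hrc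
  have := congrArg Fin.val (ha.1.1 hrc)
  have hi := i.2
  have hj := j.2
  simp only [peakPosition_val] at this
  split_ifs at this <;> omega

theorem IsRCAlt.lt_add {n : ℕ} {a : Fin (2 * n) → ℕ} (ha : IsRCAlt n a) {i j : Fin (2 * n)}
    (hi : (i : ℕ) % 2 = 0) (hij : (i : ℕ) + j = 2 * n ∨ (i : ℕ) + j + 2 = 2 * n) :
    2 * n + 1 < a i + a j := by
  have hj := j.2
  have hi2 := i.2
  have hrc := ha.2.2 j
  have hvj := Finset.mem_Icc.1 (ha.1.2 j)
  have hlt : a ⟨2 * n - 1 - j, by omega⟩ < a i := by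
    rcases hij with h | h
    · have := ha.2.1 (i - 1) (by omega)
      rw [if_neg (by omega)] at this
      convert this using 3 <;> omega
    · have := ha.2.1 i (by omega)
      rw [if_pos hi] at this
      convert this using 3
      omega
  omega

theorem IsRCAlt.isCompatibleWord {n : ℕ} {a : Fin (2 * n) → ℕ} (ha : IsRCAlt n a) :
    IsCompatibleWord n (List.ofFn fun i => centredLabel n (a (peakPosition n i))) := by
  have hv := fun i => Finset.mem_Icc.1 (ha.1.2 i)
  rw [isCompatibleWord_ofFn]
  refine ⟨fun i j hij => ?_, fun i => ?_, fun h => ?_, fun i h => ?_⟩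
  · have hne := ha.add_peakPosition_ne i j
    have hi := hv (peakPosition n i)
    have hj := hv (peakPosition n j)
    have heq : a (peakPosition n i) = a (peakPosition n j) := by
      simp only [centredLabel] at hij
      split_ifs at hij <;> omega
    have := congrArg Fin.val (ha.1.1 heq)
    simp only [peakPosition_val] at this
    split_ifs at this <;> omega
  · have hi := hv (peakPosition n i)
    simp only [centredLabel]
    split_ifs <;> omega
  · have hi := hv (peakPosition n ⟨0, h⟩)
    have := ha.lt_add (i := peakPosition n ⟨0, h⟩) (j := peakPosition n ⟨0, h⟩)
      (by rw [peakPosition_val]; split_ifs <;> simp at * <;> omega)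
      (by rw [peakPosition_val]; split_ifs <;> simp at * <;> omega)
    simp only [centredLabel]
    split_ifs <;> omega
  · have hi := hv (peakPosition n ⟨i, by omega⟩)
    have hj := hv (peakPosition n ⟨i + 1, h⟩)
    have := ha.lt_add (i := peakPosition n ⟨i, by omega⟩) (j := peakPosition n ⟨i + 1, h⟩)
      (by rw [peakPosition_val]; split_ifs <;> simp at * <;> omega)
      (by simp only [peakPosition_val]; split_ifs <;> omega)
    simp only [centredLabel, Compatible]
    split_ifs <;> omega

theorem centredLabel_injOn {n v w : ℕ} (hv : v ∈ Finset.Icc 1 (2 * n))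
    (hw : w ∈ Finset.Icc 1 (2 * n)) (h : centredLabel n v = centredLabel n w) : v = w := by
  rw [Finset.mem_Icc] at hv hw
  simp only [centredLabel] at h
  split_ifs at h <;> omega

/-- The distance of a position from the centre. -/
def centreDistance (n : ℕ) (k : Fin (2 * n)) : Fin n :=
  ⟨if n ≤ k then k - n else n - 1 - k, by have := k.2; split_ifs <;> omega⟩

theorem centreDistance_val (n : ℕ) (k : Fin (2 * n)) : (centreDistance n k : ℕ) =
    if n ≤ k then (k : ℕ) - n else n - 1 - k := rfl

theorem exists_isRCAlt_of_isCompatibleWord {n : ℕ} (e : Fin n → ℤ)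
    (he : IsCompatibleWord n (List.ofFn e)) :
    ∃ a, IsRCAlt n a ∧ ∀ i, centredLabel n (a (peakPosition n i)) = e i := by
  obtain ⟨hinj, hrange, hzero, hchain⟩ := (isCompatibleWord_ofFn e).1 he
  let v : Fin n → ℕ := fun i => (if 0 < e i then 2 * n + 1 - e i else -e i).toNat
  have hv : ∀ i, (v i : ℤ) = if 0 < e i then 2 * n + 1 - e i else -e i := by
    intro i
    have := hrange i
    simp only [v]
    split_ifs <;> omega
  have hvr : ∀ i, 1 ≤ v i ∧ v i ≤ 2 * n := by
    intro i
    have := hv i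
    have := hrange i
    split_ifs at * <;> omega
  have hve : ∀ i j, v i = v j ∨ v i + v j = 2 * n + 1 → i = j := by
    intro i j hij
    apply hinj
    have := hv i
    have := hv j
    have := hrange i
    have := hrange j
    dsimp only
    split_ifs at * <;> omega
  have hvs : ∀ i j : Fin n, ((i : ℕ) + 1 = j ∨ (j : ℕ) + 1 = i ∨ ((i : ℕ) = 0 ∧ (j : ℕ) = 0)) →
      2 * n + 1 < v i + v j := by
    have hstep : ∀ i j : Fin n, (i : ℕ) + 1 = j → 2 * n + 1 < v i + v j := by
      rintro ⟨i, hi⟩ ⟨j, hj⟩ h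
      simp only at h
      subst h
      have hc := hchain i hj
      have := hv ⟨i, hi⟩
      have := hv ⟨i + 1, hj⟩
      have := hrange ⟨i, hi⟩
      have := hrange ⟨i + 1, hj⟩
      unfold Compatible at hc
      split_ifs at * <;> omega
    rintro i j (h | h | ⟨hi, hj⟩)
    · exact hstep i j h
    · rw [add_comm (v i)]; exact hstep j i h
    · obtain rfl : i = j := Fin.ext (by omega)
      obtain ⟨i, hlt⟩ := i
      simp only at hi
      subst hi
      have h0 := hzero hlt
      have := hv ⟨0, hlt⟩
      have := hrange ⟨0, hlt⟩
      rw [if_pos h0] at *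
      omega
  let a : Fin (2 * n) → ℕ := fun k => if (k : ℕ) % 2 = 0 then v (centreDistance n k)
    else 2 * n + 1 - v (centreDistance n k)
  refine ⟨a, ⟨⟨fun k l hkl => ?_, fun k => ?_⟩, fun k hk => ?_, fun k => ?_⟩, fun i => ?_⟩
  · have hk := hvr (centreDistance n k)
    have hl := hvr (centreDistance n l)
    have hd := hve (centreDistance n k) (centreDistance n l)
    simp only [a] at hkl
    have hd' := hd (by split_ifs at hkl <;> omega)
    rw [hd'] at hkl
    have hval := congrArg Fin.val hd'
    simp only [centreDistance_val] at hval
    have := k.2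
    have := l.2
    apply Fin.ext
    split_ifs at hkl hval <;> omega
  · have hk := hvr (centreDistance n k)
    simp only [a, Finset.mem_Icc]
    split_ifs <;> omega
  · have h1 := hvr (centreDistance n ⟨k, by omega⟩)
    have h2 := hvr (centreDistance n ⟨k + 1, hk⟩)
    have hs := hvs (centreDistance n ⟨k, by omega⟩) (centreDistance n ⟨k + 1, hk⟩) (by
      simp only [centreDistance_val]
      split_ifs <;> omega)
    simp only [a]
    split_ifs <;> omega
  · have hd : centreDistance n ⟨2 * n - 1 - k, by have := k.2; omega⟩ = centreDistance n k := by
      apply Fin.ext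
      have := k.2
      simp only [centreDistance_val]
      split_ifs <;> omega
    have := hvr (centreDistance n k)
    simp only [a, hd]
    split_ifs <;> omega
  · have hd : centreDistance n (peakPosition n i) = i := by
      apply Fin.ext
      have := i.2
      simp only [centreDistance_val, peakPosition_val]
      split_ifs <;> omega
    have hp : (peakPosition n i : ℕ) % 2 = 0 := by
      have := i.2
      rw [peakPosition_val]
      split_ifs <;> omega
    have := hv i
    have := hrange i
    simp only [a, hd, hp, if_true, centredLabel]
    split_ifs at * <;> omega

theorem IsRCAlt.ext {n : ℕ} {a b : Fin (2 * n) → ℕ} (ha : IsRCAlt n a) (hb : IsRCAlt n b)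
    (h : ∀ i, a (peakPosition n i) = b (peakPosition n i)) : a = b := by
  have heven : ∀ k : Fin (2 * n), (k : ℕ) % 2 = 0 → a k = b k := by
    intro k hk
    have hp : peakPosition n (centreDistance n k) = k := by
      apply Fin.ext
      have := k.2
      simp only [centreDistance_val, peakPosition_val]
      split_ifs <;> omega
    rw [← hp, h]
  funext k
  by_cases hk : (k : ℕ) % 2 = 0
  · exact heven k hk
  · have h1 := ha.2.2 k
    have h2 := hb.2.2 k
    have := heven ⟨2 * n - 1 - k, by have := k.2; omega⟩ (by have := k.2; simp only; omega)
    have := Finset.mem_Icc.1 (ha.1.2 k)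
    have := Finset.mem_Icc.1 (hb.1.2 k)
    omega

/-- The word of signed labels of an rc-invariant alternating permutation. -/
def rcAltWord (n : ℕ) (a : {a : Fin (2 * n) → ℕ // IsRCAlt n a}) :
    {l : List ℤ // IsCompatibleWord n l} :=
  ⟨_, a.2.isCompatibleWord⟩

theorem rcAltWord_bijective (n : ℕ) : Function.Bijective (rcAltWord n) := by
  constructor
  · rintro ⟨a, ha⟩ ⟨b, hb⟩ h
    have h := List.ofFn_injective (congrArg Subtype.val h)
    exact Subtype.ext (ha.ext hb fun i =>
      centredLabel_injOn (ha.1.2 _) (hb.1.2 _) (congrFun h i))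
  · rintro ⟨l, hl⟩
    obtain rfl : l.length = n := by simpa using hl.1.length_eq
    obtain ⟨a, ha, h⟩ := exists_isRCAlt_of_isCompatibleWord l.get (by rwa [List.ofFn_get])
    refine ⟨⟨a, ha⟩, Subtype.ext ?_⟩
    simp only [rcAltWord, h]
    exact List.ofFn_get l

/-- For every positive integer `n` there is a bijection between the set
`ℜₙ` of rc-invariant alternating permutations of `{1, …, 2n}` and the set `𝒫ₙ` of
labeled ballot paths of length `n`; in particular `|ℜₙ| = |𝒫ₙ|`. -/
theorem rcAlt_equiv_lbp (n : ℕ) (hn : 0 < n) :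
    Nonempty ({a : Fin (2 * n) → ℕ // IsRCAlt n a} ≃
      {pw : (Fin n → Bool) × (Fin n → ℕ) // IsLBP n pw}) ∧
    Nat.card {a : Fin (2 * n) → ℕ // IsRCAlt n a} =
      Nat.card {pw : (Fin n → Bool) × (Fin n → ℕ) // IsLBP n pw} := by
  obtain ⟨e, -⟩ := exists_equiv_compatibleWord_lbp n
  let f := (Equiv.ofBijective _ (rcAltWord_bijective n)).trans e
  exact ⟨⟨f⟩, Nat.card_congr f⟩
end
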